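/- Van Trees' inequality: Let λ : ℝᵖ → ℝ be a C^∞ probability density with compact support, let p : ℝᵐ × ℝᵖ → [0,∞), written p(y|θ), be such that y ↦ p(y|θ) is a probability density on ℝᵐ for each θ, θ ↦ p(y|θ) is continuously differentiable on the support of λ, and the score has mean zero: ∫ ∇_θ p(y|θ) dy = 0 for every θ in the support of λ. Let ψ : ℝᵖ → ℝᵏ be differentiable and let ψ̂ : ℝᵐ → ℝᵏ be any measurable estimator. Define the Fisher information I_p(θ) = ∫ ∇_θ log p(y|θ) (∇_θ log p(y|θ))ᵀ p(y|θ) dy (assumed finite and continuous in θ on the support of λ) and the prior information J(λ) = ∫ ∇ log λ(θ) (∇ log λ(θ))ᵀ λ(θ) dθ (assumed finite). Assume the matrix E[I_p(θ)] + J(λ) = ∫ I_p(θ)λ(θ)dθ + J(λ) is positive definite, and assume all the integrals below are finite. Then ∫∫ (ψ̂(y) − ψ(θ))(ψ̂(y) − ψ(θ))ᵀ p(y|θ)λ(θ) dy dθ ⪰ (∫ Dψ(θ) λ(θ) dθ) · (∫ I_p(θ)λ(θ)dθ + J(λ))⁻¹ · (∫ Dψ(θ) λ(θ) dθ)ᵀ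 in the Loewner order, where Dψ(θ) ∈ ℝ^{k×p} is the Jacobian of ψ at θ. -/

import Mathlib

open MeasureTheory Matrix

/-- The Fisher information matrix
`I_p(θ) = ∫ ∇_θ log p(y|θ) (∇_θ log p(y|θ))ᵀ p(y|θ) dy`. -/
noncomputable def fisherInfoMatrix {M P : ℕ}
    (p : EuclideanSpace ℝ (Fin M) → EuclideanSpace ℝ (Fin P) → ℝ)
    (θ : EuclideanSpace ℝ (Fin P)) : Matrix (Fin P) (Fin P) ℝ :=
  Matrix.of fun i j =>
    ∫ y, gradient (fun t => Real.log (p y t)) θ i *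
      gradient (fun t => Real.log (p y t)) θ j * p y θ

/-- The prior (location) information matrix
`J(λ) = ∫ ∇ log λ(θ) (∇ log λ(θ))ᵀ λ(θ) dθ`. -/
noncomputable def priorInfoMatrix {P : ℕ}
    (lam : EuclideanSpace ℝ (Fin P) → ℝ) : Matrix (Fin P) (Fin P) ℝ :=
  Matrix.of fun i j =>
    ∫ θ, gradient (fun t => Real.log (lam t)) θ i *
      gradient (fun t => Real.log (lam t)) θ j * lam θ

/-- The Jacobian matrix `Dψ(θ) ∈ ℝ^{k×p}` of `ψ : ℝᵖ → ℝᵏ` at `θ`. -/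
noncomputable def jacobianMatrix {P K : ℕ}
    (ψ : EuclideanSpace ℝ (Fin P) → EuclideanSpace ℝ (Fin K))
    (θ : EuclideanSpace ℝ (Fin P)) : Matrix (Fin K) (Fin P) ℝ :=
  Matrix.of fun i j => fderiv ℝ ψ θ (EuclideanSpace.single j 1) i

/-- The prior-averaged Fisher information `∫ I_p(θ) λ(θ) dθ`. -/
noncomputable def avgFisherMatrix {M P : ℕ}
    (p : EuclideanSpace ℝ (Fin M) → EuclideanSpace ℝ (Fin P) → ℝ)
    (lam : EuclideanSpace ℝ (Fin P) → ℝ) : Matrix (Fin P) (Fin P) ℝ :=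
  Matrix.of fun i j => ∫ θ, fisherInfoMatrix p θ i j * lam θ

/-- The prior-averaged Jacobian `∫ Dψ(θ) λ(θ) dθ`. -/
noncomputable def avgJacobianMatrix {P K : ℕ}
    (ψ : EuclideanSpace ℝ (Fin P) → EuclideanSpace ℝ (Fin K))
    (lam : EuclideanSpace ℝ (Fin P) → ℝ) : Matrix (Fin K) (Fin P) ℝ :=
  Matrix.of fun i j => ∫ θ, jacobianMatrix ψ θ i j * lam θ

/-- The Bayes risk matrix
`∫∫ (ψ̂(y) − ψ(θ))(ψ̂(y) − ψ(θ))ᵀ p(y|θ) λ(θ) dy dθ`. -/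
noncomputable def bayesRiskMatrix {M P K : ℕ}
    (p : EuclideanSpace ℝ (Fin M) → EuclideanSpace ℝ (Fin P) → ℝ)
    (lam : EuclideanSpace ℝ (Fin P) → ℝ)
    (ψ : EuclideanSpace ℝ (Fin P) → EuclideanSpace ℝ (Fin K))
    (ψhat : EuclideanSpace ℝ (Fin M) → EuclideanSpace ℝ (Fin K)) :
    Matrix (Fin K) (Fin K) ℝ :=
  Matrix.of fun i j =>
    ∫ θ, (∫ y, (ψhat y i - ψ θ i) * (ψhat y j - ψ θ j) * p y θ) * lam θ

open Filter Topology

theorem vt_sections {E F : Type*} [TopologicalSpace E] [TopologicalSpace.SeparableSpace E]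
    [FirstCountableTopology E]
    [MeasurableSpace F] (ν : Measure F) (q : E → F → ℝ)
    (hc : ∀ y, Continuous fun θ => q θ y) (hm : ∀ θ, AEStronglyMeasurable (q θ) ν) :
    ∃ s : Set F, MeasurableSet s ∧ (∀ᵐ y ∂ν, y ∈ s) ∧
      ∀ θ, StronglyMeasurable (s.indicator (q θ)) := by
  rcases isEmpty_or_nonempty E with hE | hE
  · exact ⟨Set.univ, .univ, by simp, fun θ => hE.elim θ⟩
  have h1 : ∀ᵐ y ∂ν, ∀ n, q (TopologicalSpace.denseSeq E n) y
      = (hm (TopologicalSpace.denseSeq E n)).mk _ y :=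
    ae_all_iff.2 fun n => (hm _).ae_eq_mk
  obtain ⟨t, hts, htm, ht0⟩ := exists_measurable_superset_of_null (ae_iff.1 h1)
  have hin : ∀ y ∈ tᶜ, ∀ n, q (TopologicalSpace.denseSeq E n) y
      = (hm (TopologicalSpace.denseSeq E n)).mk _ y := by
    intro y hy
    by_contra h
    exact hy (hts h)
  refine ⟨tᶜ, htm.compl, ?_, fun θ => ?_⟩
  · rw [ae_iff]; simpa using ht0
  · have hd : θ ∈ closure (Set.range (TopologicalSpace.denseSeq E)) :=
      TopologicalSpace.denseRange_denseSeq E θ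
    obtain ⟨x, hx, hxt⟩ := mem_closure_iff_seq_limit.1 hd
    choose k hk using hx
    refine stronglyMeasurable_of_tendsto (u := atTop)
      (f := fun n => (tᶜ).indicator (q (x n))) (fun n => ?_) ?_
    · rw [← hk n]
      have : (tᶜ).indicator (q (TopologicalSpace.denseSeq E (k n))) =
          (tᶜ).indicator ((hm (TopologicalSpace.denseSeq E (k n))).mk _) := by
        apply Set.indicator_congr
        intro y hy
        exact hin y hy _
      rw [this]
      exact (hm _).stronglyMeasurable_mk.indicator htm.compl
    · rw [tendsto_pi_nhds]
      intro y
      by_cases hy : y ∈ tᶜ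
      · simp only [Set.indicator_of_mem hy]
        exact ((hc y).tendsto θ).comp hxt
      · simp only [Set.indicator_of_notMem hy]
        exact tendsto_const_nhds

theorem vt_meas {E F : Type*} [NormedAddCommGroup E] [NormedSpace ℝ E]
    [FiniteDimensional ℝ E] [MeasurableSpace E] [BorelSpace E]
    [MeasurableSpace F] (μ : Measure E) (ν : Measure F) [SFinite μ] [SFinite ν] (q : E → F → ℝ)
    (hd : ∀ y, Differentiable ℝ fun θ => q θ y) (hm : ∀ θ, AEStronglyMeasurable (q θ) ν) (w : E) :
    AEStronglyMeasurable (fun z : E × F => q z.1 z.2) (μ.prod ν) ∧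
    AEStronglyMeasurable (fun z : E × F => fderiv ℝ (fun t => q t z.2) z.1 w) (μ.prod ν) := by
  obtain ⟨s, hs, hsa, hsm⟩ := vt_sections ν q (fun y => (hd y).continuous) hm
  have hae : ∀ᵐ z ∂(μ.prod ν), z.2 ∈ s :=
    (Measure.quasiMeasurePreserving_snd (μ := μ) (ν := ν)).ae hsa
  have hu : StronglyMeasurable (Function.uncurry fun θ => s.indicator (q θ)) := by
    apply stronglyMeasurable_uncurry_of_continuous_of_stronglyMeasurable _ hsm
    intro y
    by_cases hy : y ∈ s
    · simpa only [Set.indicator_of_mem hy] using (hd y).continuous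
    · simpa only [Set.indicator_of_notMem hy] using continuous_const
  have h1 : AEStronglyMeasurable (fun z : E × F => q z.1 z.2) (μ.prod ν) := by
    refine ⟨_, hu, ?_⟩
    filter_upwards [hae] with z hz
    simp [Function.uncurry, hz]
  refine ⟨h1, ?_⟩
  refine aestronglyMeasurable_of_tendsto_ae (u := atTop)
    (f := fun (n : ℕ) (z : E × F) => (n : ℝ) • (q (z.1 + (n : ℝ)⁻¹ • w) z.2 - q z.1 z.2)) ?_ ?_
  · intro n
    refine AEStronglyMeasurable.const_smul (𝕜 := ℝ) (AEStronglyMeasurable.sub ?_ h1) (n : ℝ)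
    refine ⟨fun z => (Function.uncurry fun θ => s.indicator (q θ)) (z.1 + (n : ℝ)⁻¹ • w, z.2),
      hu.comp_measurable (by fun_prop), ?_⟩
    filter_upwards [hae] with z hz
    simp [Function.uncurry, hz]
  · refine Eventually.of_forall fun z => ?_
    refine (hd z.2 z.1).hasFDerivAt.lim w ?_
    simpa using tendsto_natCast_atTop_atTop (R := ℝ)

theorem vt_core {M P : ℕ} (q : EuclideanSpace ℝ (Fin P) → EuclideanSpace ℝ (Fin M) → ℝ)
    (lam : EuclideanSpace ℝ (Fin P) → ℝ)
    (g : EuclideanSpace ℝ (Fin M) → ℝ) (h : EuclideanSpace ℝ (Fin P) → ℝ)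
    (w : EuclideanSpace ℝ (Fin P))
    (hq0 : ∀ θ y, 0 ≤ q θ y)
    (hd : ∀ y, Differentiable ℝ fun θ => q θ y)
    (hqi : ∀ θ, Integrable (q θ))
    (hql : ∀ θ, ∫ y, q θ y = lam θ) (hlam : Integrable lam)
    (hg : Measurable g) (hh : Differentiable ℝ h)
    (hB1 : ∀ θ, Integrable fun y => (g y - h θ) ^ 2 * q θ y)
    (hB2 : Integrable fun θ => ∫ y, (g y - h θ) ^ 2 * q θ y)
    (hW1 : ∀ θ, Integrable fun y => (fderiv ℝ (fun t => q t y) θ w) ^ 2 / q θ y)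
    (hW2 : Integrable fun θ => ∫ y, (fderiv ℝ (fun t => q t y) θ w) ^ 2 / q θ y)
    (hA : Integrable fun θ => fderiv ℝ h θ w * lam θ) :
    2 * ∫ θ, fderiv ℝ h θ w * lam θ ≤
      (∫ θ, ∫ y, (g y - h θ) ^ 2 * q θ y) +
      ∫ θ, ∫ y, (fderiv ℝ (fun t => q t y) θ w) ^ 2 / q θ y := by
  obtain ⟨mq, mD⟩ := vt_meas (volume : Measure (EuclideanSpace ℝ (Fin P)))
    (volume : Measure (EuclideanSpace ℝ (Fin M))) q hd (fun θ => (hqi θ).1) w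
  set D : EuclideanSpace ℝ (Fin P) → EuclideanSpace ℝ (Fin M) → ℝ :=
    fun θ y => fderiv ℝ (fun t => q t y) θ w with hD
  have hD0 : ∀ θ y, q θ y = 0 → D θ y = 0 := by
    intro θ y h0
    have : IsLocalMin (fun t => q t y) θ :=
      Eventually.of_forall fun t => by simpa [h0] using hq0 t y
    simp [hD, this.fderiv_eq_zero]
  let π := (volume : Measure (EuclideanSpace ℝ (Fin P))).prod
    (volume : Measure (EuclideanSpace ℝ (Fin M)))
  have mf : Measurable fun z : EuclideanSpace ℝ (Fin P) × EuclideanSpace ℝ (Fin M) =>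
      g z.2 - h z.1 := (hg.comp measurable_snd).sub (hh.continuous.measurable.comp measurable_fst)
  -- joint integrability of nonnegative functions
  have key : ∀ G : EuclideanSpace ℝ (Fin P) → EuclideanSpace ℝ (Fin M) → ℝ,
      AEStronglyMeasurable (fun z : _ × _ => G z.1 z.2) π → (∀ θ y, 0 ≤ G θ y) →
      (∀ θ, Integrable (G θ)) → Integrable (fun θ => ∫ y, G θ y) →
      Integrable (fun z : _ × _ => G z.1 z.2) π := by
    intro G h1 h2 h3 h4
    refine (integrable_prod_iff h1).2 ⟨Eventually.of_forall h3, ?_⟩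
    simpa only [Real.norm_of_nonneg (h2 _ _)] using h4
  have iB : Integrable (fun z : _ × _ => (g z.2 - h z.1) ^ 2 * q z.1 z.2) π :=
    key (fun θ y => (g y - h θ) ^ 2 * q θ y) ((mf.pow_const 2).aestronglyMeasurable.mul mq)
      (fun θ y => mul_nonneg (sq_nonneg _) (hq0 _ _)) hB1 hB2
  have iW : Integrable (fun z : _ × _ => (D z.1 z.2) ^ 2 / q z.1 z.2) π :=
    key (fun θ y => (D θ y) ^ 2 / q θ y)
      ((mD.aemeasurable.pow_const 2).div mq.aemeasurable).aestronglyMeasurable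
      (fun θ y => div_nonneg (sq_nonneg _) (hq0 _ _)) hW1 hW2
  have iq : Integrable (fun z : _ × _ => q z.1 z.2) π :=
    key q mq hq0 hqi (by simpa only [hql] using hlam)
  have iX : Integrable (fun z : _ × _ => (g z.2 - h z.1) * D z.1 z.2) π := by
    refine (iB.add iW).mono' (mf.aestronglyMeasurable.mul mD) (Eventually.of_forall fun z => ?_)
    rcases (hq0 z.1 z.2).eq_or_lt with h0 | h0
    · simp [hD0 _ _ h0.symm, ← h0]
    · simp only [Pi.add_apply, Real.norm_eq_abs]
      have e : (g z.2 - h z.1) ^ 2 * q z.1 z.2 + D z.1 z.2 ^ 2 / q z.1 z.2 =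
        (((g z.2 - h z.1) * q z.1 z.2) ^ 2 + D z.1 z.2 ^ 2) / q z.1 z.2 := by
        field_simp
      rw [e, le_div_iff₀ h0, ← abs_of_pos h0, ← abs_mul, abs_of_pos h0]
      rw [abs_le]
      constructor <;> nlinarith [sq_nonneg ((g z.2 - h z.1) * q z.1 z.2 + D z.1 z.2),
        sq_nonneg ((g z.2 - h z.1) * q z.1 z.2 - D z.1 z.2),
        sq_nonneg ((g z.2 - h z.1) * q z.1 z.2), sq_nonneg (D z.1 z.2)]
  have iF : Integrable (fun z : _ × _ => (g z.2 - h z.1) * q z.1 z.2) π := by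
    refine (iB.add iq).mono' (mf.aestronglyMeasurable.mul mq) (Eventually.of_forall fun z => ?_)
    simp only [Pi.add_apply, Real.norm_eq_abs, abs_mul, abs_of_nonneg (hq0 z.1 z.2)]
    rw [← add_one_mul]
    refine mul_le_mul_of_nonneg_right ?_ (hq0 _ _)
    rw [abs_le]
    constructor <;> nlinarith [sq_nonneg (g z.2 - h z.1 + 1), sq_nonneg (g z.2 - h z.1 - 1)]
  have iA : Integrable (fun z : _ × _ => fderiv ℝ h z.1 w * q z.1 z.2) π := by
    refine (integrable_prod_iff ?_).2 ⟨Eventually.of_forall fun θ => (hqi θ).const_mul (fderiv ℝ h θ w), ?_⟩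
    · exact ((measurable_fderiv_apply_const ℝ h w).comp measurable_fst).aestronglyMeasurable.mul mq
    · refine hA.norm.congr (Eventually.of_forall fun θ => ?_)
      simp only [norm_mul, Real.norm_of_nonneg (hq0 _ _), integral_const_mul, hql]
      rw [Real.norm_of_nonneg (r := lam θ)]
      rw [← hql]; exact integral_nonneg (hq0 θ)
  -- integration by parts
  have ibp : ∫ z, (g z.2 - h z.1) * D z.1 z.2 ∂π = ∫ θ, fderiv ℝ h θ w * lam θ := by
    have e2 : ∫ z, fderiv ℝ h z.1 w * q z.1 z.2 ∂π = ∫ θ, fderiv ℝ h θ w * lam θ := by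
      rw [integral_prod _ iA]
      simp only [integral_const_mul, hql]
    rw [← e2, integral_prod_symm _ iX, integral_prod_symm _ iA]
    apply integral_congr_ae
    filter_upwards [iX.prod_left_ae, iF.prod_left_ae, iA.prod_left_ae] with y h1 h2 h3
    have hfd : ∀ θ, fderiv ℝ (fun θ => g y - h θ) θ w = - fderiv ℝ h θ w := by
      intro θ; simp [fderiv_const_sub]
    have := integral_mul_fderiv_eq_neg_fderiv_mul_of_integrable
      (μ := (volume : Measure (EuclideanSpace ℝ (Fin P))))
      (f := fun θ => g y - h θ) (g := fun θ => q θ y) (v := w)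
      (by simp only [hfd, neg_mul]; exact h3.neg) h1 h2
      (fun x _ => (hh x).const_sub _) (fun x _ => hd y x)
    simp only [hfd, neg_mul, integral_neg, neg_neg] at this
    exact this
  have pos : 0 ≤ ∫ z, ((g z.2 - h z.1) ^ 2 * q z.1 z.2 + D z.1 z.2 ^ 2 / q z.1 z.2
      - 2 * ((g z.2 - h z.1) * D z.1 z.2)) ∂π := by
    refine integral_nonneg fun z => ?_
    rcases (hq0 z.1 z.2).eq_or_lt with h0 | h0
    · simp [hD0 _ _ h0.symm, ← h0]
    · have e : (g z.2 - h z.1) ^ 2 * q z.1 z.2 + D z.1 z.2 ^ 2 / q z.1 z.2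
          - 2 * ((g z.2 - h z.1) * D z.1 z.2) =
          ((g z.2 - h z.1) * q z.1 z.2 - D z.1 z.2) ^ 2 / q z.1 z.2 := by
        field_simp; ring
      simp only [Pi.zero_apply]
      rw [e]; positivity
  rw [integral_sub (f := fun z : _ × _ => (g z.2 - h z.1) ^ 2 * q z.1 z.2
    + D z.1 z.2 ^ 2 / q z.1 z.2) (iB.add iW) (iX.const_mul 2), integral_add iB iW, integral_const_mul, ibp,
    integral_prod _ iB, integral_prod _ iW] at pos
  linarith


theorem vt_grad {P : ℕ} (f : EuclideanSpace ℝ (Fin P) → ℝ) (θ w : EuclideanSpace ℝ (Fin P)) :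
    fderiv ℝ f θ w = ∑ i, gradient f θ i * w i := by
  rw [← toDual_gradient, InnerProductSpace.toDual_apply_apply, PiLp.inner_apply]
  simp [mul_comm]

theorem vt_sq {n : ℕ} (g w : Fin n → ℝ) (c : ℝ) :
    (∑ i, g i * w i) ^ 2 * c = ∑ i, ∑ j, w i * w j * (g i * g j * c) := by
  rw [sq, Finset.sum_mul_sum, Finset.sum_mul]
  refine Finset.sum_congr rfl fun i _ => ?_
  rw [Finset.sum_mul]
  refine Finset.sum_congr rfl fun j _ => ?_
  ring

theorem vt_log {P : ℕ} (f : EuclideanSpace ℝ (Fin P) → ℝ) (θ w : EuclideanSpace ℝ (Fin P))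
    (hf : DifferentiableAt ℝ f θ) (h0 : ∀ t, 0 ≤ f t) :
    fderiv ℝ f θ w = fderiv ℝ (fun t => Real.log (f t)) θ w * f θ := by
  by_cases h : f θ = 0
  · have : IsLocalMin f θ := Eventually.of_forall fun t => by simpa [h] using h0 t
    simp [this.fderiv_eq_zero, h]
  · rw [fderiv.log hf h]
    simp
    field_simp

theorem vt_diffAt {P : ℕ} (lam f : EuclideanSpace ℝ (Fin P) → ℝ)
    (hf : ContDiffOn ℝ 1 f (tsupport lam)) {θ : EuclideanSpace ℝ (Fin P)}
    (hl : Continuous lam) (h : lam θ ≠ 0) :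
    DifferentiableAt ℝ f θ := by
  have hn : tsupport lam ∈ 𝓝 θ :=
    mem_of_superset (hl.isOpen_support.mem_nhds h) (subset_tsupport lam)
  exact (hf.contDiffAt hn).differentiableAt one_ne_zero

theorem vt_diff {P : ℕ} (lam f : EuclideanSpace ℝ (Fin P) → ℝ)
    (hl : Differentiable ℝ lam) (hs : HasCompactSupport lam) (h0 : ∀ θ, 0 ≤ lam θ)
    (hf : ContDiffOn ℝ 1 f (tsupport lam)) :
    Differentiable ℝ fun θ => f θ * lam θ := by
  intro θ
  by_cases h : lam θ = 0
  · have hmin : IsLocalMin lam θ := Eventually.of_forall fun t => by simpa [h] using h0 t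
    have hd : HasFDerivAt lam (0 : EuclideanSpace ℝ (Fin P) →L[ℝ] ℝ) θ := by
      rw [← hmin.fderiv_eq_zero]; exact (hl θ).hasFDerivAt
    obtain ⟨C, hC⟩ := IsCompact.exists_bound_of_continuousOn hs hf.continuousOn
    have : HasFDerivAt (fun θ => f θ * lam θ) (0 : EuclideanSpace ℝ (Fin P) →L[ℝ] ℝ) θ := by
      rw [hasFDerivAt_iff_isLittleO] at hd ⊢
      refine Asymptotics.IsBigO.trans_isLittleO ?_ hd
      refine Asymptotics.IsBigO.of_bound C (Eventually.of_forall fun t => ?_)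
      simp only [h, mul_zero, sub_zero, _root_.zero_apply, norm_mul]
      by_cases ht : t ∈ tsupport lam
      · exact mul_le_mul_of_nonneg_right (hC t ht) (norm_nonneg _)
      · simp [image_eq_zero_of_notMem_tsupport ht]
    exact this.differentiableAt
  · exact (vt_diffAt lam f hf hl.continuous h).mul (hl θ)

/-- inner computation of the joint information -/
theorem vt_info {M P : ℕ}
    (lam : EuclideanSpace ℝ (Fin P) → ℝ)
    (p : EuclideanSpace ℝ (Fin M) → EuclideanSpace ℝ (Fin P) → ℝ)
    (hl : Differentiable ℝ lam)
    (hlam_nonneg : ∀ θ, 0 ≤ lam θ)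
    (hp_nonneg : ∀ y θ, 0 ≤ p y θ)
    (hpi : ∀ θ, Integrable fun y => p y θ)
    (hp_density : ∀ θ, (∫ y, p y θ) = 1)
    (hp_diff : ∀ y, ContDiffOn ℝ 1 (fun θ => p y θ) (tsupport lam))
    (hscore : ∀ θ ∈ tsupport lam, (∫ y, gradient (fun t => p y t) θ) = 0)
    (hfisher_fin : ∀ θ ∈ tsupport lam, ∀ i j,
      Integrable (fun y => gradient (fun t => Real.log (p y t)) θ i *
        gradient (fun t => Real.log (p y t)) θ j * p y θ))
    (w θ : EuclideanSpace ℝ (Fin P)) :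
    Integrable (fun y => (fderiv ℝ (fun t => p y t * lam t) θ w) ^ 2 / (p y θ * lam θ)) ∧
    ∫ y, (fderiv ℝ (fun t => p y t * lam t) θ w) ^ 2 / (p y θ * lam θ) =
      ∑ i, ∑ j, w i * w j * (fisherInfoMatrix p θ i j * lam θ +
        gradient (fun t => Real.log (lam t)) θ i *
        gradient (fun t => Real.log (lam t)) θ j * lam θ) := by
  by_cases h : lam θ = 0
  · simp [h]
  have hmem : θ ∈ tsupport lam := subset_tsupport lam h
  have hpd : ∀ y, DifferentiableAt ℝ (fun t => p y t) θ :=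
    fun y => vt_diffAt lam _ (hp_diff y) hl.continuous h
  -- directional derivative of the density
  have hpm : ∀ u, AEStronglyMeasurable (fun y => fderiv ℝ (fun t => p y t) θ u) := by
    intro u
    refine aestronglyMeasurable_of_tendsto_ae (u := atTop)
      (f := fun (n : ℕ) y => (n : ℝ) • (p y (θ + (n : ℝ)⁻¹ • u) - p y θ)) ?_ ?_
    · intro n
      exact AEStronglyMeasurable.const_smul (𝕜 := ℝ)
        (AEStronglyMeasurable.sub (hpi _).1 (hpi _).1) (n : ℝ)
    · refine Eventually.of_forall fun y => ?_
      refine (hpd y).hasFDerivAt.lim u ?_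
      simpa using tendsto_natCast_atTop_atTop (R := ℝ)
  have e1 : ∀ u y, fderiv ℝ (fun t => p y t) θ u =
      fderiv ℝ (fun t => Real.log (p y t)) θ u * p y θ :=
    fun u y => vt_log _ θ u (hpd y) (hp_nonneg y)
  have e2 : fderiv ℝ lam θ w = fderiv ℝ (fun t => Real.log (lam t)) θ w * lam θ :=
    vt_log _ θ w (hl θ) hlam_nonneg
  have i1 : ∀ u : EuclideanSpace ℝ (Fin P),
      Integrable fun y => fderiv ℝ (fun t => Real.log (p y t)) θ u ^ 2 * p y θ := by
    intro u
    simp only [vt_grad, vt_sq]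
    exact integrable_finsetSum _ fun i _ => integrable_finsetSum _ fun j _ =>
      (hfisher_fin θ hmem i j).const_mul _
  have i2 : ∀ u, Integrable fun y => fderiv ℝ (fun t => p y t) θ u := by
    intro u
    refine ((i1 u).add (hpi θ)).mono' (hpm u) (Eventually.of_forall fun y => ?_)
    rw [e1]
    simp only [Pi.add_apply, Real.norm_eq_abs, abs_mul, abs_of_nonneg (hp_nonneg y θ)]
    rw [← add_one_mul]
    refine mul_le_mul_of_nonneg_right ?_ (hp_nonneg _ _)
    generalize fderiv ℝ (fun t => Real.log (p y t)) θ u = x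
    rw [abs_le]
    constructor <;> nlinarith [sq_nonneg (x + 1), sq_nonneg (x - 1)]
  have z2 : ∫ y, fderiv ℝ (fun t => p y t) θ w = 0 := by
    have ig : ∀ i, ∫ y, gradient (fun t => p y t) θ i = 0 := by
      intro i
      have hg : Integrable fun y => gradient (fun t => p y t) θ := by
        refine Integrable.of_eval_piLp fun j => ?_
        refine (i2 (EuclideanSpace.single j 1)).congr (Eventually.of_forall fun y => ?_)
        simp [vt_grad]
      have := (EuclideanSpace.proj (𝕜 := ℝ) i).integral_comp_comm hg
      rw [hscore θ hmem] at this
      simpa using this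
    have igi : ∀ i, Integrable fun y => gradient (fun t => p y t) θ i := by
      intro j
      refine (i2 (EuclideanSpace.single j 1)).congr (Eventually.of_forall fun y => ?_)
      simp [vt_grad]
    simp only [vt_grad]
    rw [integral_finsetSum _ fun i _ => (igi i).mul_const _]
    simp [integral_mul_const, ig]
  set b := fderiv ℝ (fun t => Real.log (lam t)) θ w with hb
  have e3 : ∀ y, (fderiv ℝ (fun t => p y t * lam t) θ w) ^ 2 / (p y θ * lam θ) =
      fderiv ℝ (fun t => Real.log (p y t)) θ w ^ 2 * p y θ * lam θ +
      2 * b * lam θ * fderiv ℝ (fun t => p y t) θ w + b ^ 2 * lam θ * p y θ := by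
    intro y
    rw [fderiv_fun_mul (hpd y) (hl θ)]
    simp only [_root_.add_apply, _root_.smul_apply, smul_eq_mul]
    rw [e1 w y, e2]
    by_cases h0 : p y θ = 0
    · simp [h0]
    · field_simp
      ring
  have j1 := (i1 w).mul_const (lam θ)
  have j2 := (i2 w).const_mul (2 * b * lam θ)
  have j3 := (hpi θ).const_mul (b ^ 2 * lam θ)
  simp only [e3]
  refine ⟨(j1.add j2).add j3, ?_⟩
  rw [integral_add (f := fun y => fderiv ℝ (fun t => Real.log (p y t)) θ w ^ 2 * p y θ * lam θ +
      2 * b * lam θ * fderiv ℝ (fun t => p y t) θ w) (j1.add j2) j3, integral_add j1 j2, integral_const_mul, integral_const_mul,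
    integral_mul_const, z2, hp_density]
  have e4 : ∫ y, fderiv ℝ (fun t => Real.log (p y t)) θ w ^ 2 * p y θ =
      ∑ i, ∑ j, w i * w j * fisherInfoMatrix p θ i j := by
    simp only [vt_grad, vt_sq]
    rw [integral_finsetSum _ fun i _ => integrable_finsetSum _ fun j _ =>
      (hfisher_fin θ hmem i j).const_mul _]
    refine Finset.sum_congr rfl fun i _ => ?_
    rw [integral_finsetSum _ fun j _ => (hfisher_fin θ hmem i j).const_mul _]
    simp only [integral_const_mul, fisherInfoMatrix, Matrix.of_apply]
  rw [e4, hb, vt_grad, mul_zero, add_zero, mul_one, vt_sq]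
  simp only [Finset.sum_mul, ← Finset.sum_add_distrib]
  refine Finset.sum_congr rfl fun i _ => Finset.sum_congr rfl fun j _ => ?_
  ring

theorem vt_quad {m n : ℕ} (A : Matrix (Fin m) (Fin n) ℝ) (v : Fin m → ℝ) (w : Fin n → ℝ) :
    v ⬝ᵥ (A *ᵥ w) = ∑ i, ∑ j, v i * w j * A i j := by
  simp only [dotProduct, mulVec, Finset.mul_sum]
  refine Finset.sum_congr rfl fun i _ => Finset.sum_congr rfl fun j _ => ?_
  ring

/-- Van Trees' inequality: under the stated regularity and integrability
hypotheses, the Bayes risk matrix dominates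
`(∫ Dψ λ)(∫ I_p λ + J(λ))⁻¹(∫ Dψ λ)ᵀ` in the Loewner order. -/
theorem van_trees_inequality {M P K : ℕ}
    (lam : EuclideanSpace ℝ (Fin P) → ℝ)
    (p : EuclideanSpace ℝ (Fin M) → EuclideanSpace ℝ (Fin P) → ℝ)
    (ψ : EuclideanSpace ℝ (Fin P) → EuclideanSpace ℝ (Fin K))
    (ψhat : EuclideanSpace ℝ (Fin M) → EuclideanSpace ℝ (Fin K))
    -- λ is a C^∞ probability density with compact support
    (hlam_smooth : ContDiff ℝ (⊤ : ℕ∞) lam)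
    (hlam_supp : HasCompactSupport lam)
    (hlam_nonneg : ∀ θ, 0 ≤ lam θ)
    (hlam_density : (∫ θ, lam θ) = 1)
    -- p(·|θ) is a probability density for each θ, C¹ in θ on the support of λ
    (hp_nonneg : ∀ y θ, 0 ≤ p y θ)
    (hp_density : ∀ θ, (∫ y, p y θ) = 1)
    (hp_diff : ∀ y, ContDiffOn ℝ 1 (fun θ => p y θ) (tsupport lam))
    -- the score has mean zero on the support of λ
    (hscore : ∀ θ ∈ tsupport lam, (∫ y, gradient (fun t => p y t) θ) = 0)
    -- ψ is differentiable, ψ̂ is measurable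
    (hψ : Differentiable ℝ ψ)
    (hψhat : Measurable ψhat)
    -- the Fisher information is finite and continuous in θ on the support of λ
    (hfisher_fin : ∀ θ ∈ tsupport lam, ∀ i j,
      Integrable (fun y => gradient (fun t => Real.log (p y t)) θ i *
        gradient (fun t => Real.log (p y t)) θ j * p y θ))
    (hfisher_cont : ∀ i j,
      ContinuousOn (fun θ => fisherInfoMatrix p θ i j) (tsupport lam))
    -- J(λ) is finite
    (hJ_fin : ∀ i j, Integrable (fun θ =>
      gradient (fun t => Real.log (lam t)) θ i *
        gradient (fun t => Real.log (lam t)) θ j * lam θ))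
    -- all remaining integrals are finite
    (hF_int : ∀ i j, Integrable (fun θ => fisherInfoMatrix p θ i j * lam θ))
    (hJac_int : ∀ i j, Integrable (fun θ => jacobianMatrix ψ θ i j * lam θ))
    (hrisk_inner : ∀ θ, ∀ i j,
      Integrable (fun y => (ψhat y i - ψ θ i) * (ψhat y j - ψ θ j) * p y θ))
    (hrisk_outer : ∀ i j, Integrable (fun θ =>
      (∫ y, (ψhat y i - ψ θ i) * (ψhat y j - ψ θ j) * p y θ) * lam θ))
    -- E[I_p(θ)] + J(λ) is positive definite
    (hPD : (avgFisherMatrix p lam + priorInfoMatrix lam).PosDef) :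
    (bayesRiskMatrix p lam ψ ψhat -
        avgJacobianMatrix ψ lam * (avgFisherMatrix p lam + priorInfoMatrix lam)⁻¹ *
          (avgJacobianMatrix ψ lam)ᵀ).PosSemidef := by
  have hl : Differentiable ℝ lam := hlam_smooth.differentiable (by simp)
  have hpi : ∀ θ, Integrable fun y => p y θ := fun θ =>
    Integrable.of_integral_ne_zero (by rw [hp_density]; exact one_ne_zero)
  have hlami : Integrable lam :=
    Integrable.of_integral_ne_zero (by rw [hlam_density]; exact one_ne_zero)
  have main : ∀ (v : Fin K → ℝ) (w : Fin P → ℝ),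
      2 * (v ⬝ᵥ (avgJacobianMatrix ψ lam *ᵥ w)) ≤ v ⬝ᵥ (bayesRiskMatrix p lam ψ ψhat *ᵥ v) +
        w ⬝ᵥ ((avgFisherMatrix p lam + priorInfoMatrix lam) *ᵥ w) := by
    intro v w
    have hinfo := vt_info lam p hl hlam_nonneg hp_nonneg hpi hp_density hp_diff hscore
      hfisher_fin (WithLp.toLp 2 w)
    have hB : ∀ θ y, ((∑ i, ψhat y i * v i) - ∑ i, ψ θ i * v i) ^ 2 * (p y θ * lam θ) =
        ∑ i, ∑ j, v i * v j * ((ψhat y i - ψ θ i) * (ψhat y j - ψ θ j) * p y θ * lam θ) := by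
      intro θ y
      rw [← Finset.sum_sub_distrib]
      simp only [← sub_mul]
      rw [vt_sq]
      simp only [mul_assoc]
    have hBint : ∀ θ, ∫ y, ((∑ i, ψhat y i * v i) - ∑ i, ψ θ i * v i) ^ 2 * (p y θ * lam θ) =
        ∑ i, ∑ j, v i * v j *
          ((∫ y, (ψhat y i - ψ θ i) * (ψhat y j - ψ θ j) * p y θ) * lam θ) := by
      intro θ
      simp only [hB]
      rw [integral_finsetSum _ fun i _ => integrable_finsetSum _ fun j _ =>
        ((hrisk_inner θ i j).mul_const _).const_mul _]
      refine Finset.sum_congr rfl fun i _ => ?_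
      rw [integral_finsetSum _ fun j _ => ((hrisk_inner θ i j).mul_const _).const_mul _]
      simp only [integral_const_mul, integral_mul_const]
    have hψc : ∀ i, Differentiable ℝ fun θ => ψ θ i := fun i =>
      (EuclideanSpace.proj (𝕜 := ℝ) i).differentiable.comp hψ
    have hfd : ∀ θ, fderiv ℝ (fun θ => ∑ i, ψ θ i * v i) θ (WithLp.toLp 2 w) * lam θ =
        ∑ i, ∑ j, v i * w j * (jacobianMatrix ψ θ i j * lam θ) := by
      intro θ
      rw [fderiv_fun_sum fun i _ => (hψc i θ).mul_const _]
      simp only [_root_.sum_apply, Finset.sum_mul]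
      refine Finset.sum_congr rfl fun i _ => ?_
      rw [fderiv_mul_const (hψc i θ)]
      have e : fderiv ℝ (fun θ => ψ θ i) θ (WithLp.toLp 2 w) =
          ∑ j, w j * jacobianMatrix ψ θ i j := by
        have : fderiv ℝ (fun θ => ψ θ i) θ =
            (EuclideanSpace.proj (𝕜 := ℝ) i : EuclideanSpace ℝ (Fin K) →L[ℝ] ℝ).comp
              (fderiv ℝ ψ θ) :=
          ((EuclideanSpace.proj (𝕜 := ℝ) i).hasFDerivAt.comp θ (hψ θ).hasFDerivAt).fderiv
        rw [vt_grad]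
        refine Finset.sum_congr rfl fun j _ => ?_
        have e5 : gradient (fun θ => ψ θ i) θ j =
            fderiv ℝ (fun θ => ψ θ i) θ (EuclideanSpace.single j 1) := by
          simp [vt_grad]
        rw [e5, this]
        simp [jacobianMatrix, mul_comm]
      simp only [_root_.smul_apply, smul_eq_mul, e, Finset.mul_sum, Finset.sum_mul]
      refine Finset.sum_congr rfl fun j _ => ?_
      ring
    have core := vt_core (fun θ y => p y θ * lam θ) lam (fun y => ∑ i, ψhat y i * v i)
      (fun θ => ∑ i, ψ θ i * v i) (WithLp.toLp 2 w)
      (fun θ y => mul_nonneg (hp_nonneg _ _) (hlam_nonneg _))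
      (fun y => vt_diff lam (fun θ => p y θ) hl hlam_supp hlam_nonneg (hp_diff y))
      (fun θ => (hpi θ).mul_const _)
      (fun θ => by rw [integral_mul_const, hp_density, one_mul]) hlami
      (by fun_prop)
      (by fun_prop)
      (fun θ => by
        simp only [hB]
        exact integrable_finsetSum _ fun i _ => integrable_finsetSum _ fun j _ =>
          ((hrisk_inner θ i j).mul_const _).const_mul _)
      (by
        simp only [hBint]
        exact integrable_finsetSum _ fun i _ => integrable_finsetSum _ fun j _ =>
          (hrisk_outer i j).const_mul _)
      (fun θ => (hinfo θ).1)
      (by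
        simp only [fun θ => (hinfo θ).2]
        exact integrable_finsetSum _ fun i _ => integrable_finsetSum _ fun j _ =>
          ((hF_int i j).add (hJ_fin i j)).const_mul _)
      (by
        simp only [hfd]
        exact integrable_finsetSum _ fun i _ => integrable_finsetSum _ fun j _ =>
          (hJac_int i j).const_mul _)
    simp only [hfd, hBint, fun θ => (hinfo θ).2] at core
    have hFJ : ∀ i j, Integrable fun θ => fisherInfoMatrix p θ i j * lam θ +
        gradient (fun t => Real.log (lam t)) θ i *
        gradient (fun t => Real.log (lam t)) θ j * lam θ :=
      fun i j => (hF_int i j).add (hJ_fin i j)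
    rw [vt_quad, vt_quad, vt_quad]
    convert core using 2
    · congr 1
      rw [integral_finsetSum _ fun i _ => integrable_finsetSum _ fun j _ =>
          (hJac_int i j).const_mul _]
      refine Finset.sum_congr rfl fun i _ => ?_
      rw [integral_finsetSum _ fun j _ => (hJac_int i j).const_mul _]
      simp only [integral_const_mul, avgJacobianMatrix, Matrix.of_apply]
    · rw [integral_finsetSum _ fun i _ => integrable_finsetSum _ fun j _ =>
          (hrisk_outer i j).const_mul _]
      refine Finset.sum_congr rfl fun i _ => ?_
      rw [integral_finsetSum _ fun j _ => (hrisk_outer i j).const_mul _]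
      simp only [integral_const_mul, bayesRiskMatrix, Matrix.of_apply]
    · rw [integral_finsetSum _ fun i _ => integrable_finsetSum _ fun j _ =>
          (hFJ i j).const_mul _]
      refine Finset.sum_congr rfl fun i _ => ?_
      rw [integral_finsetSum _ fun j _ => (hFJ i j).const_mul _]
      refine Finset.sum_congr rfl fun j _ => ?_
      rw [integral_const_mul, integral_add (hF_int i j) (hJ_fin i j)]
      simp only [avgFisherMatrix, priorInfoMatrix, Matrix.of_apply, Matrix.add_apply]
  generalize hC : avgFisherMatrix p lam + priorInfoMatrix lam = C at *
  have hBs : (bayesRiskMatrix p lam ψ ψhat).IsHermitian := by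
    ext i j
    simp only [bayesRiskMatrix, Matrix.conjTranspose_apply, Matrix.of_apply, star_trivial]
    simp only [mul_comm (ψhat _ j - ψ _ j)]
  generalize bayesRiskMatrix p lam ψ ψhat = B at *
  generalize avgJacobianMatrix ψ lam = A at *
  have hCu : IsUnit C.det := (Matrix.isUnit_iff_isUnit_det C).1 hPD.isUnit
  refine .of_dotProduct_mulVec_nonneg (hBs.sub ?_) fun v => ?_
  · have := Matrix.isHermitian_mul_mul_conjTranspose A hPD.isHermitian.inv
    simpa using this
  · have h1 := main v (C⁻¹ *ᵥ (Aᵀ *ᵥ v))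
    have h3 : C *ᵥ (C⁻¹ *ᵥ (Aᵀ *ᵥ v)) = Aᵀ *ᵥ v := by
      rw [Matrix.mulVec_mulVec, Matrix.mul_nonsing_inv C hCu, Matrix.one_mulVec]
    rw [h3] at h1
    have h2 : (C⁻¹ *ᵥ (Aᵀ *ᵥ v)) ⬝ᵥ (Aᵀ *ᵥ v) = v ⬝ᵥ (A *ᵥ (C⁻¹ *ᵥ (Aᵀ *ᵥ v))) := by
      rw [Matrix.mulVec_transpose, dotProduct_comm, ← Matrix.dotProduct_mulVec]
    rw [h2] at h1
    rw [star_trivial, Matrix.sub_mulVec, dotProduct_sub, ← Matrix.mulVec_mulVec,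
      ← Matrix.mulVec_mulVec]
    linarith
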